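/- arXiv:1207.1151 — 3 statements merged into one kernel-verified Lean document; each statement's English description precedes it below -/
import Mathlib

section
/- Let p ∈ ℂ[x] be a nonzero polynomial. There exists an anti-involution of 𝒟ᵃ_p preserving the principal ℤ-gradation if and only if there exists c ∈ ℂ such that p(x) = (−1)^{deg p}·p(−x + c) for all x ∈ ℂ. -/
noncomputable section

/-- ℂ[t,t⁻¹] as a ℂ-vector space with basis {t^j}_{j∈ℤ}; t^j is `Finsupp.single j 1`. -/
abbrev LaurentV : Type := ℤ →₀ ℂ

/-- The regular differential operator `t^k f(D)` (where D = t·d/dt), acting by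
t^j ↦ f(j)·t^{j+k}. -/
def op (k : ℤ) (f : Polynomial ℂ) : Module.End ℂ LaurentV :=
  Finsupp.lsum ℂ fun j => f.eval (j : ℂ) • Finsupp.lsingle (j + k)

/-- The graded piece (𝒟ᵃ_p)_j = {t^j f(D) p(D) : f ∈ ℂ[x]}. -/
def Dgrade (p : Polynomial ℂ) (j : ℤ) : Submodule ℂ (Module.End ℂ LaurentV) :=
  Submodule.span ℂ {A | ∃ f : Polynomial ℂ, A = op j (f * p)}

/-- 𝒟ᵃ_p = 𝒟ᵃ·p(D). -/
def Dp (p : Polynomial ℂ) : Submodule ℂ (Module.End ℂ LaurentV) :=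
  Submodule.span ℂ {A | ∃ (k : ℤ) (f : Polynomial ℂ), A = op k (f * p)}

/-- σ is an anti-involution: it is ℂ-linear (built into the type), involutive, and
reverses products. -/
def IsAntiInvolutionOn (p : Polynomial ℂ) (σ : ↥(Dp p) →ₗ[ℂ] ↥(Dp p)) : Prop :=
  (∀ A : ↥(Dp p), σ (σ A) = A) ∧
  (∀ A B W : ↥(Dp p),
    (W : Module.End ℂ LaurentV) = (A : Module.End ℂ LaurentV) * (B : Module.End ℂ LaurentV) →
    ((σ W : Module.End ℂ LaurentV)) = (σ B : Module.End ℂ LaurentV) * (σ A : Module.End ℂ LaurentV))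

/-- σ preserves the principal ℤ-gradation. -/
def PreservesGrading (p : Polynomial ℂ) (σ : ↥(Dp p) →ₗ[ℂ] ↥(Dp p)) : Prop :=
  ∀ (j : ℤ) (A : ↥(Dp p)), (A : Module.End ℂ LaurentV) ∈ Dgrade p j →
    ((σ A : Module.End ℂ LaurentV)) ∈ Dgrade p j

/-- σ(t^k f(D) p(D)) = (-1)^{deg p}·e^k·t^k f(−D−k+c)p(D). -/
def SigmaFormula (p : Polynomial ℂ) (c e : ℂ) (σ : ↥(Dp p) →ₗ[ℂ] ↥(Dp p)) : Prop :=
  ∀ (k : ℤ) (f : Polynomial ℂ) (A : ↥(Dp p)), (A : Module.End ℂ LaurentV) = op k (f * p) →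
    ((σ A : Module.End ℂ LaurentV)) =
      ((-1 : ℂ) ^ p.natDegree * e ^ k) •
        op k ((f.comp (Polynomial.C (c - (k : ℂ)) - Polynomial.X)) * p)

/-- The graded piece (𝒟_p^±)_k = {d ∈ (𝒟_p)_k : σ_±(d) = −d}, as a set. -/
def DpmGradeSet (p : Polynomial ℂ) (c e : ℂ) (k : ℤ) : Set (Module.End ℂ LaurentV) :=
  {A | ∃ f : Polynomial ℂ, A = op k (f * p) ∧
    ((-1 : ℂ) ^ p.natDegree * e ^ k) •
      op k ((f.comp (Polynomial.C (c - (k : ℂ)) - Polynomial.X)) * p) = -A}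

/-- The graded piece (𝒟_p^±)_k, as a ℂ-subspace. -/
def DpmGrade (p : Polynomial ℂ) (c e : ℂ) (k : ℤ) : Submodule ℂ (Module.End ℂ LaurentV) :=
  Submodule.span ℂ (DpmGradeSet p c e k)

/-- V has finite codimension in W. -/
def FinCodimIn {M : Type*} [AddCommGroup M] [Module ℂ M] (V W : Submodule ℂ M) : Prop :=
  FiniteDimensional ℂ (↥W ⧸ Submodule.comap W.subtype V)

theorem op_single (k j : ℤ) (f : Polynomial ℂ) (a : ℂ) :
    op k f (Finsupp.single j a) = Finsupp.single (j + k) (f.eval (j : ℂ) * a) := by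
  simp [op]

theorem op_mul_op (k l : ℤ) (f g : Polynomial ℂ) :
    op k f * op l g = op (k + l) (f.comp (Polynomial.X + Polynomial.C (l : ℂ)) * g) := by
  refine Finsupp.lhom_ext fun j a => ?_
  simp only [Module.End.mul_apply, op_single, Polynomial.eval_mul, Polynomial.eval_comp,
    Polynomial.eval_add, Polynomial.eval_X, Polynomial.eval_C]
  push_cast
  rw [add_assoc, add_comm l k, mul_assoc]

/-- `op k` as a linear map in the polynomial. -/
def opLinear (k : ℤ) : Polynomial ℂ →ₗ[ℂ] Module.End ℂ LaurentV where
  toFun := op k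
  map_add' f g := Finsupp.lhom_ext fun j a => by
    simp [op_single, add_mul, Finsupp.single_add]
  map_smul' c f := Finsupp.lhom_ext fun j a => by
    simp only [RingHom.id_apply, LinearMap.smul_apply, op_single, Polynomial.eval_smul,
      smul_eq_mul, mul_assoc, Finsupp.smul_single]

theorem opLinear_apply (k : ℤ) (f : Polynomial ℂ) : opLinear k f = op k f := rfl

/-- The parametrization `∑ f_k ↦ ∑ t^k f_k(D) p(D)` of `Dp p`. -/
def dpParam (p : Polynomial ℂ) : (ℤ →₀ Polynomial ℂ) →ₗ[ℂ] Module.End ℂ LaurentV :=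
  Finsupp.lsum ℂ fun k => opLinear k ∘ₗ LinearMap.mulRight ℂ p

theorem dpParam_single (p : Polynomial ℂ) (k : ℤ) (f : Polynomial ℂ) :
    dpParam p (Finsupp.single k f) = op k (f * p) := by
  rw [dpParam, Finsupp.lsum_single, LinearMap.comp_apply, LinearMap.mulRight_apply,
    opLinear_apply]

theorem dpParam_apply_single (p : Polynomial ℂ) (F : ℤ →₀ Polynomial ℂ) (k j : ℤ) :
    dpParam p F (Finsupp.single j 1) (j + k) = (F k * p).eval (j : ℂ) := by
  induction F using Finsupp.induction_linear with
  | zero => simp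
  | add F G hF hG => simp [hF, hG, add_mul]
  | single l f =>
    rw [dpParam_single, op_single, Finsupp.single_apply, Finsupp.single_apply]
    by_cases h : l = k <;> simp [h]

theorem eq_of_eval_intCast_eq {f g : Polynomial ℂ}
    (h : ∀ j : ℤ, f.eval (j : ℂ) = g.eval (j : ℂ)) : f = g :=
  Polynomial.eq_of_infinite_eval_eq f g <|
    (Set.infinite_range_of_injective (Int.cast_injective (α := ℂ))).mono <| by
      rintro _ ⟨j, rfl⟩
      exact h j

theorem dpParam_injective {p : Polynomial ℂ} (hp : p ≠ 0) :
    Function.Injective (dpParam p) := by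
  intro F G h
  ext1 k
  refine mul_right_cancel₀ hp (eq_of_eval_intCast_eq fun j => ?_)
  rw [← dpParam_apply_single, ← dpParam_apply_single, h]

theorem op_mul_right_injective {p : Polynomial ℂ} (hp : p ≠ 0) (k : ℤ) {f g : Polynomial ℂ}
    (h : op k (f * p) = op k (g * p)) : f = g := by
  rw [← dpParam_single, ← dpParam_single] at h
  exact Finsupp.single_injective k (dpParam_injective hp h)

theorem op_mem_Dp (p : Polynomial ℂ) (k : ℤ) (f : Polynomial ℂ) : op k (f * p) ∈ Dp p :=
  Submodule.subset_span ⟨k, f, rfl⟩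

theorem op_mem_Dgrade (p : Polynomial ℂ) (k : ℤ) (f : Polynomial ℂ) :
    op k (f * p) ∈ Dgrade p k :=
  Submodule.subset_span ⟨f, rfl⟩

theorem mem_Dgrade_iff {p : Polynomial ℂ} {k : ℤ} {A : Module.End ℂ LaurentV} :
    A ∈ Dgrade p k ↔ ∃ f, A = op k (f * p) := by
  refine ⟨fun h => ?_, ?_⟩
  · have hle : Dgrade p k ≤ LinearMap.range (opLinear k ∘ₗ LinearMap.mulRight ℂ p) := by
      refine Submodule.span_le.2 ?_
      rintro _ ⟨f, rfl⟩
      exact ⟨f, rfl⟩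
    obtain ⟨f, rfl⟩ := hle h
    exact ⟨f, rfl⟩
  · rintro ⟨f, rfl⟩
    exact op_mem_Dgrade p k f

theorem range_dpParam (p : Polynomial ℂ) : LinearMap.range (dpParam p) = Dp p := by
  apply le_antisymm
  · rintro _ ⟨F, rfl⟩
    induction F using Finsupp.induction_linear with
    | zero => simp
    | add F G hF hG => rw [map_add]; exact add_mem hF hG
    | single k f => rw [dpParam_single]; exact op_mem_Dp p k f
  · refine Submodule.span_le.2 ?_
    rintro _ ⟨k, f, rfl⟩
    exact ⟨Finsupp.single k f, dpParam_single p k f⟩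

/-- The linear equivalence onto `Dp p` given by `dpParam`. -/
def dpEquiv {p : Polynomial ℂ} (hp : p ≠ 0) : (ℤ →₀ Polynomial ℂ) ≃ₗ[ℂ] Dp p :=
  (LinearEquiv.ofInjective (dpParam p) (dpParam_injective hp)).trans
    (LinearEquiv.ofEq _ _ (range_dpParam p))

theorem coe_dpEquiv {p : Polynomial ℂ} (hp : p ≠ 0) (F : ℤ →₀ Polynomial ℂ) :
    (dpEquiv hp F : Module.End ℂ LaurentV) = dpParam p F := rfl

/-- In coordinates, the map `t^k f(D) p(D) ↦ s t^k f(-D - k + c) p(D)`. -/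
def reflect (s c : ℂ) : (ℤ →₀ Polynomial ℂ) →ₗ[ℂ] (ℤ →₀ Polynomial ℂ) :=
  Finsupp.lsum ℂ fun k => Finsupp.lsingle k ∘ₗ
    (s • (Polynomial.aeval (Polynomial.C (c - k) - Polynomial.X)).toLinearMap)

theorem reflect_single (s c : ℂ) (k : ℤ) (f : Polynomial ℂ) :
    reflect s c (Finsupp.single k f) =
      Finsupp.single k (s • f.comp (Polynomial.C (c - k) - Polynomial.X)) := by
  simp [reflect, Polynomial.comp_eq_aeval]

theorem reflect_reflect {s : ℂ} (hs : s * s = 1) (c : ℂ) (F : ℤ →₀ Polynomial ℂ) :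
    reflect s c (reflect s c F) = F := by
  induction F using Finsupp.induction_linear with
  | zero => simp
  | add F G hF hG => simp [hF, hG]
  | single k f =>
    simp [reflect_single, Polynomial.comp_assoc, smul_smul, hs, Polynomial.smul_comp]

theorem exists_dpParam_mul_reflect {p : Polynomial ℂ} {s c : ℂ} (hs : s * s = 1)
    (hpc : p = s • p.comp (Polynomial.C c - Polynomial.X)) (F G : ℤ →₀ Polynomial ℂ) :
    ∃ H, dpParam p H = dpParam p F * dpParam p G ∧
      dpParam p (reflect s c H) = dpParam p (reflect s c G) * dpParam p (reflect s c F) := by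
  induction F using Finsupp.induction_linear with
  | zero => exact ⟨0, by simp⟩
  | add F F' hF hF' =>
    obtain ⟨H, h1, h2⟩ := hF
    obtain ⟨H', h1', h2'⟩ := hF'
    exact ⟨H + H', by simp [h1, h1', add_mul], by simp [h2, h2', mul_add]⟩
  | single k f =>
    induction G using Finsupp.induction_linear with
    | zero => exact ⟨0, by simp⟩
    | add G G' hG hG' =>
      obtain ⟨H, h1, h2⟩ := hG
      obtain ⟨H', h1', h2'⟩ := hG'
      exact ⟨H + H', by simp [h1, h1', mul_add], by simp [h2, h2', add_mul]⟩
    | single l g =>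
      refine ⟨Finsupp.single (k + l) ((f * p).comp (Polynomial.X + Polynomial.C (l : ℂ)) * g),
        ?_, ?_⟩
      · simp only [dpParam_single, op_mul_op, mul_assoc]
      · have hp_eval : ∀ x, p.eval x = s * p.eval (c - x) := fun x => by
          conv_lhs => rw [hpc]
          simp
        simp only [reflect_single, dpParam_single, op_mul_op]
        rw [add_comm l k]
        congr 1
        refine Polynomial.funext fun x => ?_
        simp only [Polynomial.eval_mul, Polynomial.eval_smul, Polynomial.eval_comp,
          Polynomial.eval_add, Polynomial.eval_sub, Polynomial.eval_X, Polynomial.eval_C,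
          smul_eq_mul]
        rw [hp_eval (x + k)]
        have e1 : c - ((k + l : ℤ) : ℂ) - x + l = c - k - x := by push_cast; ring
        have e2 : c - ((k + l : ℤ) : ℂ) - x = c - l - (x + k) := by push_cast; ring
        have e3 : c - (x + k) = c - k - x := by ring
        rw [e1, e2, e3]
        linear_combination (-s * f.eval (c - k - x) * p.eval (c - k - x) *
          g.eval (c - l - (x + k)) * p.eval x) * hs

theorem exists_antiInvolution {p : Polynomial ℂ} (hp : p ≠ 0) {s c : ℂ} (hs : s * s = 1)
    (hpc : p = s • p.comp (Polynomial.C c - Polynomial.X)) :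
    ∃ σ : ↥(Dp p) →ₗ[ℂ] ↥(Dp p), IsAntiInvolutionOn p σ ∧ PreservesGrading p σ := by
  refine ⟨(dpEquiv hp).conj (reflect s c), ⟨fun A => ?_, fun A B W hW => ?_⟩, fun j A hA => ?_⟩
  · simp [LinearEquiv.conj_apply, reflect_reflect hs]
  · obtain ⟨F, rfl⟩ := (dpEquiv hp).surjective A
    obtain ⟨G, rfl⟩ := (dpEquiv hp).surjective B
    obtain ⟨H, rfl⟩ := (dpEquiv hp).surjective W
    obtain ⟨K, h1, h2⟩ := exists_dpParam_mul_reflect hs hpc F G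
    obtain rfl : H = K := dpParam_injective hp (hW.trans h1.symm)
    simpa [LinearEquiv.conj_apply, coe_dpEquiv] using h2
  · obtain ⟨f, hf⟩ := mem_Dgrade_iff.1 hA
    obtain rfl : A = dpEquiv hp (Finsupp.single j f) :=
      Subtype.ext (hf.trans (dpParam_single p j f).symm)
    simp only [LinearEquiv.conj_apply, LinearMap.comp_apply, LinearEquiv.coe_coe,
      LinearEquiv.symm_apply_apply, reflect_single, coe_dpEquiv, dpParam_single]
    exact op_mem_Dgrade p j _

/-- A graded anti-involution of `Dp p`, read on coefficient polynomials. -/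
theorem exists_coeff_maps {p : Polynomial ℂ} (hp : p ≠ 0) {σ : ↥(Dp p) →ₗ[ℂ] ↥(Dp p)}
    (hσ : IsAntiInvolutionOn p σ) (hgr : PreservesGrading p σ) :
    ∃ S : ℤ → Polynomial ℂ →ₗ[ℂ] Polynomial ℂ, (∀ k f, S k (S k f) = f) ∧
      ∀ k l f g, S (k + l) ((f * p).comp (Polynomial.X + Polynomial.C (l : ℂ)) * g) =
        (S l g * p).comp (Polynomial.X + Polynomial.C (k : ℂ)) * S k f := by
  have hex : ∀ k f, ∃ g, (σ ⟨op k (f * p), op_mem_Dp p k f⟩ : Module.End ℂ LaurentV) =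
      op k (g * p) := fun k f => mem_Dgrade_iff.1 (hgr k _ (op_mem_Dgrade p k f))
  choose S hS using hex
  have hS' : ∀ k f, σ ⟨op k (f * p), op_mem_Dp p k f⟩ =
      ⟨op k (S k f * p), op_mem_Dp p k _⟩ := fun k f => Subtype.ext (hS k f)
  refine ⟨fun k => ⟨⟨S k, fun f g => ?_⟩, fun a f => ?_⟩, fun k f => ?_, fun k l f g => ?_⟩
  · have hadd : (⟨op k ((f + g) * p), op_mem_Dp p k _⟩ : Dp p) =
        ⟨op k (f * p), op_mem_Dp p k f⟩ + ⟨op k (g * p), op_mem_Dp p k g⟩ :=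
      Subtype.ext ((congrArg (op k) (add_mul f g p)).trans ((opLinear k).map_add _ _))
    have h := congrArg σ hadd
    rw [map_add, hS', hS', hS'] at h
    apply op_mul_right_injective hp k
    rw [add_mul]
    exact (congrArg Subtype.val h).trans ((opLinear k).map_add _ _).symm
  · have hsmul : (⟨op k (a • f * p), op_mem_Dp p k _⟩ : Dp p) =
        a • ⟨op k (f * p), op_mem_Dp p k f⟩ :=
      Subtype.ext ((congrArg (op k) (smul_mul_assoc a f p)).trans ((opLinear k).map_smul _ _))
    have h := congrArg σ hsmul
    rw [map_smul, hS', hS'] at h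
    apply op_mul_right_injective hp k
    rw [RingHom.id_apply, smul_mul_assoc]
    exact (congrArg Subtype.val h).trans ((opLinear k).map_smul _ _).symm
  · apply op_mul_right_injective hp k
    have h := hσ.1 ⟨op k (f * p), op_mem_Dp p k f⟩
    rw [hS', hS'] at h
    exact congrArg Subtype.val h
  · apply op_mul_right_injective hp (k + l)
    have h := hσ.2 ⟨op k (f * p), op_mem_Dp p k f⟩ ⟨op l (g * p), op_mem_Dp p l g⟩
      ⟨_, op_mem_Dp p (k + l) ((f * p).comp (Polynomial.X + Polynomial.C (l : ℂ)) * g)⟩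
      (by simp only [op_mul_op, mul_assoc])
    rw [hS', hS', hS'] at h
    simp only [op_mul_op] at h
    rw [add_comm l k] at h
    simpa only [LinearMap.coe_mk, AddHom.coe_mk, mul_assoc] using h

/-- A linear involution of `ℂ[x]` multiplicative up to the value at `1` is a
scaled substitution. -/
theorem exists_eq_C_mul_comp {S : Polynomial ℂ →ₗ[ℂ] Polynomial ℂ} (hinv : ∀ f, S (S f) = f)
    (hmul : ∀ f g, S 1 * S (f * g) = S f * S g) :
    ∃ (u : ℂ) (q : Polynomial ℂ), u * u = 1 ∧ q.comp q = Polynomial.X ∧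
      ∀ f, S f = Polynomial.C u * f.comp q := by
  have hunit : S 1 * S (S 1 * S 1) = 1 := by rw [hmul, hinv, mul_one]
  obtain ⟨u, hu, hu1⟩ := Polynomial.isUnit_iff.1 (IsUnit.of_mul_eq_one _ hunit)
  have hu0 : u ≠ 0 := hu.ne_zero
  let φ : Polynomial ℂ →ₐ[ℂ] Polynomial ℂ := AlgHom.ofLinearMap (u⁻¹ • S)
    (by simp [← hu1, Polynomial.smul_C, hu0])
    (fun f g => by
      have h := hmul f g
      rw [← hu1, ← Polynomial.smul_eq_C_mul] at h
      simp only [LinearMap.smul_apply, smul_mul_smul_comm, ← h, smul_smul]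
      congr 1
      field_simp)
  have hφ : ∀ f, S f = Polynomial.C u * f.comp (φ Polynomial.X) := fun f => by
    rw [Polynomial.comp_eq_aeval, Polynomial.aeval_algHom_apply, Polynomial.aeval_X_left_apply,
      ← Polynomial.smul_eq_C_mul]
    simp [φ, smul_smul, hu0]
  have huu : u * u = 1 := by
    have h := hinv 1
    rw [← hu1, hφ, Polynomial.C_comp, ← Polynomial.C_mul] at h
    exact Polynomial.C_injective h
  refine ⟨u, φ Polynomial.X, huu, ?_, hφ⟩
  have h := hinv Polynomial.X
  rwa [hφ, hφ, Polynomial.X_comp, Polynomial.mul_comp, Polynomial.C_comp, ← mul_assoc,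
    ← Polynomial.C_mul, huu, Polynomial.C_1, one_mul] at h

theorem eq_C_sub_X_of_comp_self {q : Polynomial ℂ} (hqq : q.comp q = Polynomial.X)
    (hshift : q.comp (Polynomial.X + Polynomial.C 1) = q - 1) :
    ∃ b : ℂ, q = Polynomial.C b - Polynomial.X := by
  have hdeg : q.natDegree = 1 := by
    have h := congrArg Polynomial.natDegree hqq
    rw [Polynomial.natDegree_comp, Polynomial.natDegree_X] at h
    exact Nat.eq_one_of_mul_eq_one_left h
  obtain ⟨a, -, b, rfl⟩ := Polynomial.natDegree_eq_one.1 hdeg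
  have h := congrArg (Polynomial.eval 0) hshift
  simp at h
  obtain rfl : a = -1 := by linear_combination h
  exact ⟨b, by simp; ring⟩

theorem exists_reflection_of_antiInvolution {p : Polynomial ℂ} (hp : p ≠ 0)
    {σ : ↥(Dp p) →ₗ[ℂ] ↥(Dp p)}
    (hσ : IsAntiInvolutionOn p σ) (hgr : PreservesGrading p σ) :
    ∃ c : ℂ, p = (-1 : ℂ) ^ p.natDegree • p.comp (Polynomial.C c - Polynomial.X) := by
  obtain ⟨S, hinv, hmul⟩ := exists_coeff_maps hp hσ hgr
  have hmul0 : ∀ f g, S 0 (f * p * g) = S 0 g * p * S 0 f := fun f g => by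
    simpa using hmul 0 0 f g
  have hmulS : ∀ f g, S 0 1 * S 0 (f * g) = S 0 f * S 0 g := fun f g => by
    apply mul_right_cancel₀ hp
    have h1 := hmul0 (f * g) 1
    have h2 := hmul0 f g
    rw [show f * g * p * 1 = f * p * g by ring] at h1
    linear_combination h2 - h1
  obtain ⟨u, q, huu, hqq, hS⟩ := exists_eq_C_mul_comp (hinv 0) hmulS
  have hu0 : Polynomial.C u ≠ 0 := fun h => by
    rw [Polynomial.C_eq_zero.1 h] at huu; simp at huu
  -- Compare the two ways of computing `S 1 (F(x) p(x) p(x + 1))`.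
  set τ : Polynomial ℂ := Polynomial.X + Polynomial.C 1 with hτ
  have hleft : ∀ f, S 1 ((f * p).comp τ * p) = S 1 p * p * S 0 f := fun f => by
    simpa [hτ] using hmul 0 1 f p
  have hright : ∀ g, S 1 (p.comp τ * p * g) = (S 0 g * p).comp τ * S 1 (p.comp τ) := fun g => by
    simpa [hτ] using hmul 1 0 (p.comp τ) g
  have hS1p : S 1 p ≠ 0 := fun h => hp (by rw [← hinv 1 p, h, map_zero])
  have hone : S 1 p * p = p.comp τ * S 1 (p.comp τ) := by
    apply mul_left_cancel₀ hu0
    have h1 := hleft 1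
    have h2 := hright 1
    simp only [hS, one_mul, mul_one, Polynomial.one_comp, Polynomial.mul_comp,
      Polynomial.C_comp] at h1 h2
    linear_combination h2 - h1
  have hshift : q.comp τ = q - 1 := by
    have h1 := hleft (Polynomial.X - 1)
    have h2 := hright Polynomial.X
    have hXτ : (Polynomial.X - 1 : Polynomial ℂ).comp τ = Polynomial.X := by simp [hτ]
    rw [Polynomial.mul_comp, hXτ, mul_assoc, mul_comm] at h1
    rw [h1] at h2
    simp only [hS, Polynomial.mul_comp, Polynomial.C_comp, Polynomial.sub_comp,
      Polynomial.X_comp, Polynomial.one_comp] at h2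
    apply mul_left_cancel₀ (mul_ne_zero hu0 (mul_ne_zero hS1p hp))
    linear_combination -h2 + Polynomial.C u * q.comp τ * hone
  obtain ⟨b, rfl⟩ := eq_C_sub_X_of_comp_self hqq hshift
  have hpq : p = Polynomial.C u * p.comp (Polynomial.C b - Polynomial.X) := by
    have h := hmul0 1 1
    simp only [one_mul, mul_one, hS, Polynomial.one_comp] at h
    rw [h, mul_right_comm, ← Polynomial.C_mul, huu, Polynomial.C_1, one_mul]
  refine ⟨b, ?_⟩
  have hlin : (Polynomial.C b - Polynomial.X : Polynomial ℂ) =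
      Polynomial.C (-1) * Polynomial.X + Polynomial.C b := by simp; ring
  have hu : u = (-1) ^ p.natDegree := by
    have h := congrArg Polynomial.leadingCoeff hpq
    rw [Polynomial.leadingCoeff_mul, Polynomial.leadingCoeff_C, hlin,
      Polynomial.leadingCoeff_comp (by rw [Polynomial.natDegree_linear (by simp)]; simp),
      Polynomial.leadingCoeff_linear (by simp)] at h
    have h1 : u * (-1) ^ p.natDegree = 1 := by
      apply mul_left_cancel₀ (Polynomial.leadingCoeff_ne_zero.2 hp)
      linear_combination -h
    have h2 : (-1 : ℂ) ^ p.natDegree * (-1) ^ p.natDegree = 1 := by rw [← mul_pow]; simp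
    linear_combination (-1) ^ p.natDegree * h1 - u * h2
  rw [← hu, Polynomial.smul_eq_C_mul]
  exact hpq

theorem antiinvolution_exists_iff (p : Polynomial ℂ) (hp : p ≠ 0) :
    (∃ σ : ↥(Dp p) →ₗ[ℂ] ↥(Dp p), IsAntiInvolutionOn p σ ∧ PreservesGrading p σ) ↔
      ∃ c : ℂ, ∀ x : ℂ, p.eval x = (-1 : ℂ) ^ p.natDegree * p.eval (-x + c) := by
  constructor
  · rintro ⟨σ, hσ, hgr⟩
    obtain ⟨c, hc⟩ := exists_reflection_of_antiInvolution hp hσ hgr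
    refine ⟨c, fun x => ?_⟩
    have h := congrArg (Polynomial.eval x) hc
    simpa [neg_add_eq_sub] using h
  · rintro ⟨c, hc⟩
    refine exists_antiInvolution hp (s := (-1) ^ p.natDegree) (c := c)
      (by rw [← mul_pow]; simp) (Polynomial.funext fun x => ?_)
    simpa [neg_add_eq_sub] using hc x

end
end

section
/- Let p ∈ ℂ[x] be nonzero with n = deg p and c ∈ ℂ such that p(x) = (−1)^n p(−x + c). Then for every k ∈ ℤ: (a) (𝒟_p^+)_k = { t^k f(D − (c−k)/2) p(D) : f ∈ ℂ[x], f(−x) = (−1)^{n+1} f(x) }; (b) (𝒟_p^−)_k = { t^k f(D − (c−k)/2) p(D) : f ∈ ℂ[x], f(−x) = (−1)^{n+k+1} f(x) }. -/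
noncomputable section

theorem op_apply_single (k : ℤ) (f : Polynomial ℂ) (j : ℤ) :
    op k f (Finsupp.single j 1) = Finsupp.single (j + k) (f.eval (j : ℂ)) := by
  simp [op]

theorem op_injective (k : ℤ) : Function.Injective (op k) := by
  intro f g h
  refine Polynomial.eq_of_infinite_eval_eq f g
    ((Set.infinite_range_of_injective (Int.cast_injective (α := ℂ))).mono ?_)
  rintro _ ⟨j, rfl⟩
  have hj := LinearMap.congr_fun h (Finsupp.single j 1)
  rw [op_apply_single, op_apply_single] at hj
  exact Finsupp.single_injective _ hj

theorem op_smul (k : ℤ) (a : ℂ) (f : Polynomial ℂ) : op k (a • f) = a • op k f := by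
  refine Finsupp.lhom_ext' fun j => LinearMap.ext_ring ?_
  simp [op_apply_single]

/-- The eigenvector condition defining the graded piece, read off on polynomials. -/
theorem smul_op_eq_neg_op_iff {p : Polynomial ℂ} (hp : p ≠ 0) (k : ℤ) (s : ℂ)
    (f g : Polynomial ℂ) :
    s • op k (g * p) = -op k (f * p) ↔ ∀ x : ℂ, s * g.eval x = -f.eval x := by
  rw [← op_smul, ← neg_one_smul ℂ (op k (f * p)), ← op_smul, (op_injective k).eq_iff,
    ← smul_mul_assoc, ← smul_mul_assoc, mul_left_inj' hp]
  constructor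
  · intro h x
    simpa using congrArg (Polynomial.eval x) h
  · intro h
    exact Polynomial.funext fun x => by simpa using h x

/-- Recentring at the fixed point of `x ↦ c - k - x` turns the eigenvector condition into
a parity condition. -/
theorem DpmGradeSet_eq {p : Polynomial ℂ} (hp : p ≠ 0) (c e : ℂ) (k : ℤ) {r : ℂ}
    (hr : r * r = 1) (hre : (-1 : ℂ) ^ p.natDegree * e ^ k = -r) :
    DpmGradeSet p c e k =
      {A | ∃ f : Polynomial ℂ, (∀ x : ℂ, f.eval (-x) = r * f.eval x) ∧
        A = op k ((f.comp (Polynomial.X - Polynomial.C ((c - (k : ℂ)) / 2))) * p)} := by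
  ext A
  simp only [DpmGradeSet, Set.mem_ofPred_eq, hre]
  constructor
  · rintro ⟨f, rfl, h⟩
    rw [smul_op_eq_neg_op_iff hp] at h
    refine ⟨f.comp (Polynomial.X + Polynomial.C ((c - (k : ℂ)) / 2)), fun x => ?_, ?_⟩
    · have hx := h (x + (c - k) / 2)
      have hc : c - k - (x + (c - k) / 2) = -x + (c - k) / 2 := by ring
      simp only [Polynomial.eval_comp, Polynomial.eval_sub, Polynomial.eval_add,
        Polynomial.eval_C, Polynomial.eval_X, hc] at hx ⊢
      linear_combination (-r) * hx - f.eval (-x + (c - k) / 2) * hr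
    · simp [Polynomial.comp_assoc]
  · rintro ⟨f, h, rfl⟩
    refine ⟨_, rfl, ?_⟩
    rw [smul_op_eq_neg_op_iff hp]
    intro x
    have hx := h (x - (c - k) / 2)
    have hc : c - k - x - (c - k) / 2 = -(x - (c - k) / 2) := by ring
    simp only [Polynomial.eval_comp, Polynomial.eval_sub, Polynomial.eval_C,
      Polynomial.eval_X, hc]
    linear_combination (-r) * hx - f.eval (x - (c - k) / 2) * hr

theorem Dpm_graded_pieces (p : Polynomial ℂ) (hp : p ≠ 0) (c : ℂ)
    (hpc : ∀ x : ℂ, p.eval x = (-1 : ℂ) ^ p.natDegree * p.eval (-x + c)) (k : ℤ) :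
    (DpmGradeSet p c 1 k =
      {A | ∃ f : Polynomial ℂ,
        (∀ x : ℂ, f.eval (-x) = (-1 : ℂ) ^ (p.natDegree + 1) * f.eval x) ∧
        A = op k ((f.comp (Polynomial.X - Polynomial.C ((c - (k : ℂ)) / 2))) * p)}) ∧
    (DpmGradeSet p c (-1) k =
      {A | ∃ f : Polynomial ℂ,
        (∀ x : ℂ, f.eval (-x) = (-1 : ℂ) ^ ((p.natDegree : ℤ) + k + 1) * f.eval x) ∧
        A = op k ((f.comp (Polynomial.X - Polynomial.C ((c - (k : ℂ)) / 2))) * p)}) := by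
  have hn : (-1 : ℂ) ^ p.natDegree * (-1 : ℂ) ^ p.natDegree = 1 := by
    rw [← mul_pow]; simp
  have hk : (-1 : ℂ) ^ k * (-1 : ℂ) ^ k = 1 := by
    rw [← mul_zpow]; simp
  have hs : (-1 : ℂ) ^ ((p.natDegree : ℤ) + k + 1) = -((-1) ^ p.natDegree * (-1) ^ k) := by
    rw [zpow_add_one₀ (by simp), zpow_add₀ (by simp), zpow_natCast]; ring
  refine ⟨DpmGradeSet_eq hp c 1 k ?_ ?_, DpmGradeSet_eq hp c (-1) k ?_ ?_⟩
  · rw [pow_succ]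
    linear_combination hn
  · rw [pow_succ, one_zpow]
    ring
  · rw [hs]
    linear_combination (-1 : ℂ) ^ k * (-1 : ℂ) ^ k * hn + hk
  · rw [hs, neg_neg]

end
end

section
/- Let f, g ∈ ℂ[x] be nonzero with deg f + deg g ≥ 1, let k, l ∈ ℤ, and set h(x) = f(x + l)g(x) − f(x)g(x + k) (so that in the Lie algebra 𝒟 one has [t^k f(D), t^l g(D)] = t^{k+l} h(D)). Then deg h = deg f + deg g − 1 if and only if (deg f)·l ≠ (deg g)·k. -/
namespace Polynomial

theorem natDegree_taylor_sub_self_mul_X_le {R : Type*} [CommRing R] (f : R[X]) (r : R) :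
    ((taylor r f - f) * X).natDegree ≤ f.natDegree := by
  rw [natDegree_le_iff_coeff_eq_zero]
  intro N hN
  obtain ⟨N, rfl⟩ : ∃ M, N = M + 1 := ⟨N - 1, by omega⟩
  rw [coeff_mul_X, coeff_sub]
  rcases (Nat.lt_succ_iff.mp hN).eq_or_lt with h | h
  · rw [← h, coeff_taylor_natDegree, coeff_natDegree, sub_self]
  · rw [coeff_eq_zero_of_natDegree_lt h,
      coeff_eq_zero_of_natDegree_lt (by rwa [natDegree_taylor]), sub_self]

theorem coeff_taylor_sub_self_mul_X_natDegree {R : Type*} [CommRing R] (f : R[X]) (r : R) :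
    ((taylor r f - f) * X).coeff f.natDegree = f.natDegree * r * f.leadingCoeff := by
  rcases hm : f.natDegree with _ | m
  · simp
  · have hd : (hasseDeriv m f).natDegree < 2 := by
      have := natDegree_hasseDeriv_le f m
      omega
    rw [coeff_mul_X, coeff_sub, taylor_coeff, eval_eq_sum_range' hd]
    simp only [Finset.sum_range_succ, Finset.sum_range_zero, hasseDeriv_coeff, leadingCoeff, hm,
      add_comm 1 m, zero_add, Nat.choose_self, Nat.choose_succ_self_right]
    push_cast
    ring

theorem degree_eq_natCast_iff_coeff_ne_zero {R : Type*} [Semiring R] {p : R[X]} {d : ℕ}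
    (hp : p.degree ≤ d) : p.degree = d ↔ p.coeff d ≠ 0 :=
  ⟨fun h => coeff_ne_zero_of_eq_degree h, fun h => le_antisymm hp (le_degree_of_ne_zero h)⟩

end Polynomial

open Polynomial

theorem bracket_degree (f g : Polynomial ℂ) (hf : f ≠ 0) (hg : g ≠ 0)
    (hdeg : 1 ≤ f.natDegree + g.natDegree) (k l : ℤ) :
    (f.comp (Polynomial.X + Polynomial.C (l : ℂ)) * g -
        f * g.comp (Polynomial.X + Polynomial.C (k : ℂ))).degree =
      ((f.natDegree + g.natDegree - 1 : ℕ) : WithBot ℕ) ↔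
    (f.natDegree : ℤ) * l ≠ (g.natDegree : ℤ) * k := by
  rw [← taylor_apply, ← taylor_apply]
  set h := taylor (l : ℂ) f * g - f * taylor (k : ℂ) g with h_def
  have hX : h * X =
      ((taylor (l : ℂ) f - f) * X) * g - f * ((taylor (k : ℂ) g - g) * X) := by
    rw [h_def]; ring
  have hf' := natDegree_taylor_sub_self_mul_X_le f (l : ℂ)
  have hg' := natDegree_taylor_sub_self_mul_X_le g (k : ℂ)
  have hXdeg : (h * X).natDegree ≤ f.natDegree + g.natDegree := by
    rw [hX]
    exact (natDegree_sub_le_of_le (natDegree_mul_le_of_le hf' le_rfl)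
      (natDegree_mul_le_of_le le_rfl hg')).trans_eq (max_self _)
  have hXcoeff : (h * X).coeff (f.natDegree + g.natDegree) =
      (f.natDegree * l - g.natDegree * k) * (f.leadingCoeff * g.leadingCoeff) := by
    rw [hX, coeff_sub, coeff_mul_add_eq_of_natDegree_le hf' le_rfl,
      coeff_mul_add_eq_of_natDegree_le le_rfl hg', coeff_taylor_sub_self_mul_X_natDegree,
      coeff_taylor_sub_self_mul_X_natDegree, coeff_natDegree, coeff_natDegree]
    ring
  obtain ⟨d, hd⟩ : ∃ d, f.natDegree + g.natDegree = d + 1 :=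
    ⟨f.natDegree + g.natDegree - 1, by omega⟩
  have hle : h.degree ≤ d := by
    rw [degree_le_iff_coeff_zero]
    intro n hn
    rw [← coeff_mul_X]
    have hn' : d < n := by exact_mod_cast hn
    exact coeff_eq_zero_of_natDegree_lt (by omega)
  rw [hd, coeff_mul_X] at hXcoeff
  rw [hd, Nat.add_sub_cancel, degree_eq_natCast_iff_coeff_ne_zero hle, hXcoeff,
    mul_ne_zero_iff_right (mul_ne_zero (leadingCoeff_ne_zero.mpr hf)
      (leadingCoeff_ne_zero.mpr hg)), sub_ne_zero]
  exact_mod_cast Iff.rfl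
end
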